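/- If G is a connected graph, L is a list assignment with |L(v)| ≥ deg(v) for every vertex v, and |L(v₀)| > deg(v₀) for at least one vertex v₀, then G has a proper L-coloring. -/

import Mathlib

/-- Greedy list coloring: if every nonempty set `S` of vertices contains a vertex with fewer
neighbors in `S` than colors in its list, then every finite set of vertices can be properly
colored from the lists. -/
theorem SimpleGraph.exists_listColoring_on_of_degenerate {V α : Type*} [Fintype V] [DecidableEq V]
    [DecidableEq α] [Nonempty α] (G : SimpleGraph V) [DecidableRel G.Adj] (L : V → Finset α)
    (h : ∀ S : Finset V, S.Nonempty → ∃ v ∈ S, (G.neighborFinset v ∩ S).card < (L v).card)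
    (S : Finset V) :
    ∃ φ : V → α, (∀ v ∈ S, φ v ∈ L v) ∧ ∀ u ∈ S, ∀ v ∈ S, G.Adj u v → φ u ≠ φ v := by
  induction S using Finset.strongInduction with
  | H S ih =>
    rcases S.eq_empty_or_nonempty with rfl | hS
    · exact ⟨fun _ => Classical.arbitrary α, by simp, by simp⟩
    obtain ⟨v, hv, hcard⟩ := h S hS
    obtain ⟨φ, hφL, hφ⟩ := ih (S.erase v) (Finset.erase_ssubset hv)
    obtain ⟨c, hc, hcφ⟩ := Finset.exists_mem_notMem_of_card_lt_card
      (Finset.card_image_le.trans_lt hcard : ((G.neighborFinset v ∩ S).image φ).card < _)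
    have hne : ∀ u ∈ S, G.Adj v u → c ≠ φ u := by
      rintro u hu hvu rfl
      exact hcφ (Finset.mem_image_of_mem φ (by simp [hu, hvu]))
    refine ⟨Function.update φ v c, fun u hu => ?_, fun u hu w hw huw => ?_⟩
    · by_cases huv : u = v
      · subst huv; simpa using hc
      · simpa [huv] using hφL u (Finset.mem_erase.2 ⟨huv, hu⟩)
    · by_cases huv : u = v
      · subst huv
        simpa [huw.ne'] using hne w hw huw
      by_cases hwv : w = v
      · subst hwv
        simpa [huv] using (hne u hu huw.symm).symm
      · simpa [huv, hwv] using
          hφ u (Finset.mem_erase.2 ⟨huv, hu⟩) w (Finset.mem_erase.2 ⟨hwv, hw⟩) huw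

/-- If `G` is connected, `|L(v)| ≥ deg(v)` for every vertex, and `|L(v₀)| > deg(v₀)` for at
least one vertex `v₀`, then `G` has a proper `L`-coloring. -/
theorem stmt8 {V : Type*} [Fintype V] [DecidableEq V] (G : SimpleGraph V)
    [DecidableRel G.Adj] (hconn : G.Connected)
    (L : V → Finset ℕ) (hL : ∀ v, G.degree v ≤ (L v).card)
    (v₀ : V) (hv₀ : G.degree v₀ < (L v₀).card) :
    ∃ φ : V → ℕ, (∀ v, φ v ∈ L v) ∧ ∀ u v, G.Adj u v → φ u ≠ φ v := by
  obtain ⟨φ, hφL, hφ⟩ := G.exists_listColoring_on_of_degenerate L (fun S ⟨s, hs⟩ => by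
    by_cases h₀ : v₀ ∈ S
    · exact ⟨v₀, h₀, (Finset.card_le_card Finset.inter_subset_left).trans_lt hv₀⟩
    obtain ⟨p⟩ := hconn.preconnected s v₀
    obtain ⟨d, -, hd, hd'⟩ := p.exists_boundary_dart (S : Set V) hs h₀
    refine ⟨d.fst, hd, (Finset.card_lt_card ?_).trans_le (hL d.fst)⟩
    refine Finset.ssubset_iff_subset_ne.2 ⟨Finset.inter_subset_left, fun heq => hd' ?_⟩
    have hmem : d.snd ∈ G.neighborFinset d.fst := by simp
    rw [← heq] at hmem
    exact (Finset.mem_inter.1 hmem).2) Finset.univ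
  exact ⟨φ, fun v => hφL v (Finset.mem_univ v),
    fun u v => hφ u (Finset.mem_univ u) v (Finset.mem_univ v)⟩
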